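/- Let A be a finite set with |A| = n ≥ 2 and f : 2^A → ℝ≥0 a symmetric submodular function with f(∅) = 0, and let (T, w) be a Gomory–Hu tree of f. For S ⊆ A, let w_T(S) denote the sum of w(e) over all edges e ∈ E(T) with exactly one endpoint in S. Then min over bijections σ : A → {1,…,n} of ∑_{i=1}^{n−1} f(A_{i,σ}) is at most min over bijections σ′ : A → {1,…,n} of ∑_{i=1}^{n−1} w_T(A_{i,σ′}). -/

import Mathlib

open scoped Classical

/-- The prefix set `A_{i,σ} = {a : σ(a) ≤ i}`, where the bijection `σ : α ≃ Fin n`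
is interpreted as a labeling by `{1,…,n}` via `a ↦ (σ a) + 1`. -/
def prefixSet {α : Type*} [Fintype α] [DecidableEq α] {n : ℕ} (σ : α ≃ Fin n) (i : ℕ) :
    Finset α :=
  Finset.univ.filter fun e => (σ e : ℕ) < i

/-- The vertex set of the connected component of `T` with the edge `e` deleted
that contains `s`. -/
noncomputable def sideOf {α : Type*} [Fintype α] (T : SimpleGraph α) (e : Sym2 α) (s : α) :
    Finset α :=
  Finset.univ.filter fun a => (T.deleteEdges {e}).Reachable s a

/-- `(T, w)` is a Gomory–Hu tree of `f`. -/
def IsGomoryHuTree {α : Type*} [Fintype α] (f : Finset α → ℝ)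
    (T : SimpleGraph α) (w : Sym2 α → ℝ) : Prop :=
  T.IsTree ∧
    ∀ s t : α, T.Adj s t →
      w s(s, t) = f (sideOf T s(s, t) s) ∧
      ∀ X : Finset α, s ∈ X → t ∉ X → f (sideOf T s(s, t) s) ≤ f X

/-- `w_T(S)`: the sum of the weights of the edges of `T` with exactly one endpoint in `S`. -/
noncomputable def cutWeight {α : Type*} [Fintype α] (T : SimpleGraph α) (w : Sym2 α → ℝ)
    (S : Finset α) : ℝ :=
  ∑ e ∈ Finset.univ.filter
      (fun e : Sym2 α => e ∈ T.edgeSet ∧ ∃ u v : α, e = s(u, v) ∧ u ∈ S ∧ v ∉ S),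
    w e

/-- The edges of `T` with exactly one endpoint in `S`. -/
noncomputable def cutEdges {α : Type*} [Fintype α] (T : SimpleGraph α) (S : Finset α) :
    Finset (Sym2 α) :=
  Finset.univ.filter
    (fun e : Sym2 α => e ∈ T.edgeSet ∧ ∃ u v : α, e = s(u, v) ∧ u ∈ S ∧ v ∉ S)

theorem mk_mem_cutEdges {α : Type*} [Fintype α] {T : SimpleGraph α} {S : Finset α} {a b : α} :
    s(a, b) ∈ cutEdges T S ↔ T.Adj a b ∧ ¬(a ∈ S ↔ b ∈ S) := by
  simp only [cutEdges, Finset.mem_filter, Finset.mem_univ, true_and, SimpleGraph.mem_edgeSet]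
  refine and_congr_right fun _ => ⟨?_, fun h => ?_⟩
  · rintro ⟨u, v, huv, hu, hv⟩
    rcases Sym2.eq_iff.mp huv with ⟨rfl, rfl⟩ | ⟨rfl, rfl⟩ <;> tauto
  · by_cases ha : a ∈ S
    · exact ⟨a, b, rfl, ha, by tauto⟩
    · exact ⟨b, a, Sym2.eq_swap, by tauto, ha⟩

/-- A symmetric submodular function vanishing on `∅` is subadditive under symmetric differences. -/
theorem symmetric_submodular_symmDiff_le {α : Type*} [Fintype α] [DecidableEq α]
    {f : Finset α → ℝ}
    (hsub : ∀ S T : Finset α, f (S ∪ T) + f (S ∩ T) ≤ f S + f T)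
    (hsym : ∀ S : Finset α, f S = f Sᶜ) (hzero : f ∅ = 0) (A B : Finset α) :
    f (symmDiff A B) ≤ f A + f B := by
  have h1 := hsub (A \ B) (B \ A)
  have h2 := hsub A Bᶜ
  have e1 : A \ B ∪ B \ A = symmDiff A B := rfl
  have e2 : (A \ B) ∩ (B \ A) = ∅ := by ext; simp; tauto
  have e3 : A ∪ Bᶜ = (B \ A)ᶜ := by ext; simp; tauto
  have e4 : A ∩ Bᶜ = A \ B := by ext; simp
  rw [e1, e2, hzero] at h1
  rw [e3, e4, ← hsym, ← hsym] at h2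
  linarith

/-- Removing an edge of a tree yields a vertex set that is separated from its complement
by this edge only. -/
theorem mem_sideOf_iff_mem_sideOf {α : Type*} [Fintype α] {T : SimpleGraph α} (hT : T.IsAcyclic)
    {u v a b : α} (huv : T.Adj u v) (hab : T.Adj a b) :
    (a ∈ sideOf T s(u, v) u ↔ b ∈ sideOf T s(u, v) u) ↔ s(a, b) ≠ s(u, v) := by
  simp only [sideOf, Finset.mem_filter, Finset.mem_univ, true_and]
  refine ⟨fun h he => ?_, fun hne => ?_⟩
  · have hb : ¬ (T.deleteEdges {s(u, v)}).Reachable u v :=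
      SimpleGraph.isBridge_iff.mp
        (SimpleGraph.isAcyclic_iff_forall_isBridge.mp hT (T.mem_edgeSet.mpr huv))
    rcases Sym2.eq_iff.mp he with ⟨rfl, rfl⟩ | ⟨rfl, rfl⟩
    · exact hb (h.mp .rfl)
    · exact hb (h.mpr .rfl)
  · have h : (T.deleteEdges {s(u, v)}).Adj a b := by
      simpa [SimpleGraph.deleteEdges_adj, hab] using hne
    exact ⟨fun h' => h'.trans h.reachable, fun h' => h'.trans h.symm.reachable⟩

theorem cutEdges_symmDiff_sideOf {α : Type*} [Fintype α] [DecidableEq α] {T : SimpleGraph α}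
    (hT : T.IsAcyclic) {S : Finset α} {u v : α} (h : s(u, v) ∈ cutEdges T S) :
    cutEdges T (symmDiff S (sideOf T s(u, v) u)) = (cutEdges T S).erase s(u, v) := by
  have huv := mk_mem_cutEdges.mp h
  ext e
  induction e using Sym2.ind with | _ a b
  rw [Finset.mem_erase, mk_mem_cutEdges, mk_mem_cutEdges]
  by_cases hab : T.Adj a b
  · have key := mem_sideOf_iff_mem_sideOf hT huv.1 hab
    have hS : s(a, b) = s(u, v) → ¬(a ∈ S ↔ b ∈ S) := fun he => by
      rw [← he] at h
      exact (mk_mem_cutEdges.mp h).2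
    simp only [Finset.mem_symmDiff]
    clear h huv
    grind
  · simp [hab]

/-- A symmetric submodular function is dominated by the cut function of a tree whose edges carry
the values of their fundamental cuts. -/
theorem le_cutWeight {α : Type*} [Fintype α] [DecidableEq α] {f : Finset α → ℝ}
    (hsub : ∀ S T : Finset α, f (S ∪ T) + f (S ∩ T) ≤ f S + f T)
    (hsym : ∀ S : Finset α, f S = f Sᶜ) (hzero : f ∅ = 0)
    {T : SimpleGraph α} (hT : T.IsTree) {w : Sym2 α → ℝ}
    (hw : ∀ s t : α, T.Adj s t → w s(s, t) = f (sideOf T s(s, t) s)) (S : Finset α) :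
    f S ≤ cutWeight T w S := by
  change f S ≤ ∑ e ∈ cutEdges T S, w e
  induction hk : (cutEdges T S).card generalizing S with
  | zero =>
    have hcut := Finset.card_eq_zero.mp hk
    have hadj : ∀ a b, T.Adj a b → (a ∈ S ↔ b ∈ S) := fun a b hab => by
      by_contra hne
      have := mk_mem_cutEdges.mpr ⟨hab, hne⟩
      simp [hcut] at this
    have hall : ∀ a b, a ∈ S ↔ b ∈ S := fun a b => by
      obtain ⟨p⟩ := hT.connected.preconnected a b
      induction p with
      | nil => rfl
      | cons hab _ ih => exact (hadj _ _ hab).trans ih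
    rw [hcut, Finset.sum_empty]
    rcases S.eq_empty_or_nonempty with rfl | ⟨a, ha⟩
    · exact hzero.le
    · have hS : S = Finset.univ := Finset.eq_univ_of_forall fun b => (hall a b).mp ha
      rw [hS, hsym, Finset.compl_univ, hzero]
  | succ k ih =>
    obtain ⟨e, he⟩ := Finset.card_pos.mp (by rw [hk]; exact k.succ_pos)
    induction e using Sym2.ind with | _ u v
    have hcut := cutEdges_symmDiff_sideOf hT.isAcyclic he
    have hle := ih (symmDiff S (sideOf T s(u, v) u))
      (by rw [hcut, Finset.card_erase_of_mem he, hk, Nat.add_sub_cancel])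
    have hsd := symmetric_submodular_symmDiff_le hsub hsym hzero
      (symmDiff S (sideOf T s(u, v) u)) (sideOf T s(u, v) u)
    rw [symmDiff_symmDiff_cancel_right, ← hw u v (mk_mem_cutEdges.mp he).1] at hsd
    rw [hcut] at hle
    rw [← Finset.sum_erase_add _ _ he]
    linarith

theorem stmt_17 {α : Type*} [Fintype α] [DecidableEq α] {n : ℕ}
    (hn : Fintype.card α = n) (hn2 : 2 ≤ n) (f : Finset α → ℝ)
    (hnn : ∀ S : Finset α, 0 ≤ f S)
    (hsub : ∀ S T : Finset α, f (S ∪ T) + f (S ∩ T) ≤ f S + f T)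
    (hsym : ∀ S : Finset α, f S = f Sᶜ)
    (hzero : f ∅ = 0)
    (T : SimpleGraph α) (w : Sym2 α → ℝ) (hGH : IsGomoryHuTree f T w) :
    sInf {v : ℝ | ∃ σ : α ≃ Fin n,
        v = ∑ i ∈ Finset.range (n - 1), f (prefixSet σ (i + 1))} ≤
      sInf {v : ℝ | ∃ σ : α ≃ Fin n,
        v = ∑ i ∈ Finset.range (n - 1), cutWeight T w (prefixSet σ (i + 1))} := by
  have : Nonempty (α ≃ Fin n) := ⟨Fintype.equivFinOfCardEq hn⟩
  refine le_csInf ⟨_, Classical.arbitrary (α ≃ Fin n), rfl⟩ ?_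
  rintro _ ⟨σ, rfl⟩
  refine csInf_le_of_le ⟨0, ?_⟩ ⟨σ, rfl⟩ (Finset.sum_le_sum fun i _ =>
    le_cutWeight hsub hsym hzero hGH.1 (fun s t h => (hGH.2 s t h).1) _)
  rintro _ ⟨τ, rfl⟩
  exact Finset.sum_nonneg fun i _ => hnn _
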